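/- (Patterned vectors, small kernels.) Let P ≥ 1 divide D, let p ∈ ℝ^P, and let w(p) ∈ ℝ^D be the patterned vector consisting of D/P consecutive copies of p. Then for every kernel size K with 1 ≤ K ≤ P and every C ≥ 1: R_{K,C}(w(p)) = (D/P)·R^P_{K,1}(p), where R^P_{K,1} denotes the induced regularizer with ambient dimension P in place of D. -/

import Mathlib

open scoped BigOperators

/-- Circular convolution of `u ∈ ℝ^K` with `v ∈ ℝ^D`:
`(u⋆v)[d] = (1/√D)·Σ_{k=0}^{K-1} u[k]·v[(d+k) mod D]`. -/
noncomputable def circConv {K D : ℕ} (u : Fin K → ℝ) (v : Fin D → ℝ) : Fin D → ℝ :=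
  fun d => (1 / Real.sqrt D) * ∑ k : Fin K, u k * v ⟨((d : ℕ) + (k : ℕ)) % D, Nat.mod_lt _ d.pos⟩

/-- Flip of a vector: `z↓[d] = z[D-1-d]`. -/
def flipVec {D : ℕ} (z : Fin D → ℝ) : Fin D → ℝ :=
  fun d => z ⟨D - 1 - (d : ℕ), by have := d.isLt; omega⟩

/-- Linear predictor realized by a two-layer linear convolutional network with
kernel size `K` and `C` output channels: `w(U,V) = Σ_c (U[:,c] ⋆ (V[:,c])↓)↓`. -/
noncomputable def predictor {K D C : ℕ} (U : Fin K → Fin C → ℝ) (V : Fin D → Fin C → ℝ) :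
    Fin D → ℝ :=
  fun d => ∑ c : Fin C, flipVec (circConv (fun k => U k c) (flipVec (fun l => V l c))) d

/-- The induced regularizer
`R_{K,C}(w) = inf { ‖U‖_F² + ‖V‖_F² : w(U,V) = w }`. -/
noncomputable def inducedReg (K D C : ℕ) (w : Fin D → ℝ) : ℝ :=
  sInf { t : ℝ | ∃ (U : Fin K → Fin C → ℝ) (V : Fin D → Fin C → ℝ),
    predictor U V = w ∧ t = (∑ k, ∑ c, (U k c) ^ 2) + ∑ l, ∑ c, (V l c) ^ 2 }

/-- Discrete Fourier transform: `ŵ[d] = (1/√D)·Σ_l w[l]·exp(-2πi·d·l/D)`. -/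
noncomputable def dft {D : ℕ} (w : Fin D → ℝ) : Fin D → ℂ :=
  fun d => (1 / (Real.sqrt D : ℂ)) * ∑ l : Fin D, (w l : ℂ) *
    Complex.exp (-((2 : ℂ) * (Real.pi : ℂ) * Complex.I * ((d : ℕ) : ℂ) * ((l : ℕ) : ℂ)) / (D : ℂ))

/-- Patterned vector: `w(p) ∈ ℝ^D` given by `w(p)[d] = p[d mod P]`. -/
def pattern (D : ℕ) {P : ℕ} (hP : 0 < P) (p : Fin P → ℝ) : Fin D → ℝ :=
  fun d => p ⟨(d : ℕ) % P, Nat.mod_lt _ hP⟩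

/-! ### Combining autocorrelations -/

/-- The autocorrelation of `a` tested against `φ`, that is `∑ φ (k - l) a k a l`. -/
noncomputable def autocorr {K : ℕ} (φ : ℤ → ℝ) (a : Fin K → ℝ) : ℝ :=
  ∑ k : Fin K, ∑ l : Fin K, φ ((k : ℤ) - (l : ℤ)) * (a k * a l)

theorem autocorr_zero {K : ℕ} (φ : ℤ → ℝ) : autocorr φ (0 : Fin K → ℝ) = 0 := by
  simp [autocorr]

theorem continuous_autocorr {K : ℕ} (φ : ℤ → ℝ) :
    Continuous (autocorr φ : (Fin K → ℝ) → ℝ) := by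
  unfold autocorr
  fun_prop

theorem autocorr_indicator_zero {K : ℕ} (a : Fin K → ℝ) :
    autocorr (fun m => if m = 0 then 1 else 0) a = ∑ k, a k ^ 2 := by
  unfold autocorr
  refine Finset.sum_congr rfl fun k _ => ?_
  rw [Finset.sum_eq_single k]
  · simp [sq]
  · intro l _ hl
    have : ((k : ℤ) - (l : ℤ)) ≠ 0 := by
      intro h
      exact hl (Fin.ext (by omega))
    simp [this]
  · simp

theorem autocorr_snoc_zero {N : ℕ} (φ : ℤ → ℝ) (b : Fin (N + 1) → ℝ) (hb : b 0 = 0) :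
    autocorr φ (Fin.snoc (fun i : Fin N => b i.succ) 0 : Fin (N + 1) → ℝ) = autocorr φ b := by
  set b' : Fin (N + 1) → ℝ := Fin.snoc (fun i : Fin N => b i.succ) 0 with hb'
  have hl : autocorr φ b' =
      ∑ i : Fin N, ∑ j : Fin N, φ ((i : ℤ) - (j : ℤ)) * (b i.succ * b j.succ) := by
    simp [autocorr, Fin.sum_univ_castSucc, hb']
  have hr : autocorr φ b =
      ∑ i : Fin N, ∑ j : Fin N, φ ((i : ℤ) - (j : ℤ)) * (b i.succ * b j.succ) := by
    simp [autocorr, Fin.sum_univ_succ, hb]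
  rw [hl, hr]

theorem autocorr_rotate {K : ℕ} (φ : ℤ → ℝ) (a b : Fin K → ℝ) (c s : ℝ)
    (h : c ^ 2 + s ^ 2 = 1) :
    autocorr φ (fun k => c * a k + s * b k) + autocorr φ (fun k => c * b k - s * a k) =
      autocorr φ a + autocorr φ b := by
  unfold autocorr
  simp only [← Finset.sum_add_distrib]
  refine Finset.sum_congr rfl fun k _ => Finset.sum_congr rfl fun l _ => ?_
  linear_combination (φ ((k : ℤ) - (l : ℤ)) * (a k * a l + b k * b l)) * h

theorem exists_rotation (x y : ℝ) :
    ∃ c s : ℝ, c ^ 2 + s ^ 2 = 1 ∧ c * y - s * x = 0 := by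
  by_cases h : x ^ 2 + y ^ 2 = 0
  · have hx : x = 0 := by nlinarith [sq_nonneg x, sq_nonneg y]
    have hy : y = 0 := by nlinarith [sq_nonneg x, sq_nonneg y]
    exact ⟨1, 0, by norm_num, by simp [hx, hy]⟩
  · have hr : Real.sqrt (x ^ 2 + y ^ 2) ^ 2 = x ^ 2 + y ^ 2 := Real.sq_sqrt (by positivity)
    have hr0 : Real.sqrt (x ^ 2 + y ^ 2) ≠ 0 := by
      intro h0
      rw [h0] at hr
      exact h (by linarith)
    refine ⟨x / Real.sqrt (x ^ 2 + y ^ 2), y / Real.sqrt (x ^ 2 + y ^ 2), ?_, ?_⟩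
    · rw [div_pow, div_pow, hr, ← add_div, div_self h]
    · ring

theorem isCompact_setOf_autocorr_add_eq {K : ℕ} (r : (ℤ → ℝ) → ℝ) :
    IsCompact {q : (Fin K → ℝ) × (Fin K → ℝ) |
      ∀ φ, autocorr φ q.1 + autocorr φ q.2 = r φ} := by
  refine Metric.isCompact_of_isClosed_isBounded ?_ ?_
  · simp only [Set.ofPred_forall]
    refine isClosed_iInter fun φ => isClosed_eq ?_ continuous_const
    exact ((continuous_autocorr φ).comp continuous_fst).add
      ((continuous_autocorr φ).comp continuous_snd)
  · set R := r fun m => if m = 0 then 1 else 0 with hR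
    refine (Metric.isBounded_closedBall (x := 0) (r := R + 1)).subset ?_
    intro q hq
    have hs : ∑ k, q.1 k ^ 2 + ∑ k, q.2 k ^ 2 = R := by
      rw [← autocorr_indicator_zero, ← autocorr_indicator_zero]
      exact hq _
    have h1 : 0 ≤ ∑ k, q.1 k ^ 2 := Finset.sum_nonneg fun _ _ => sq_nonneg _
    have h2 : 0 ≤ ∑ k, q.2 k ^ 2 := Finset.sum_nonneg fun _ _ => sq_nonneg _
    have hle (a : Fin K → ℝ) (ha : ∑ k, a k ^ 2 ≤ R) (hR0 : 0 ≤ R) : ‖a‖ ≤ R + 1 := by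
      refine (pi_norm_le_iff_of_nonneg (by linarith)).2 fun k => ?_
      have : a k ^ 2 ≤ R :=
        (Finset.single_le_sum (f := fun k => a k ^ 2) (fun _ _ => sq_nonneg _)
          (Finset.mem_univ k)).trans ha
      rw [Real.norm_eq_abs]
      exact abs_le_of_sq_le_sq (by nlinarith) (by linarith)
    rw [mem_closedBall_zero_iff]
    exact max_le (hle _ (by linarith) (by linarith)) (hle _ (by linarith) (by linarith))

/-- A real form of the Fejér–Riesz theorem: a sum of two autocorrelations is an autocorrelation.
Among all pairs with the given total autocorrelation, one maximizing `a 0 ^ 2 + b 0 ^ 2` can be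
rotated so that `b 0 = 0`; shifting `b` keeps it admissible, so maximality forces `b = 0`. -/
theorem exists_autocorr_eq_add {N : ℕ} (a b : Fin (N + 1) → ℝ) :
    ∃ g : Fin (N + 1) → ℝ, ∀ φ, autocorr φ g = autocorr φ a + autocorr φ b := by
  obtain ⟨⟨a₁, b₁⟩, hmem, hmax⟩ :=
    (isCompact_setOf_autocorr_add_eq fun φ => autocorr φ a + autocorr φ b).exists_isMaxOn
      (f := fun q : (Fin (N + 1) → ℝ) × (Fin (N + 1) → ℝ) => q.1 0 ^ 2 + q.2 0 ^ 2)
      ⟨(a, b), fun _ => rfl⟩ (by fun_prop)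
  have hmax' (a' b' : Fin (N + 1) → ℝ)
      (h : ∀ φ, autocorr φ a' + autocorr φ b' = autocorr φ a + autocorr φ b) :
      a' 0 ^ 2 + b' 0 ^ 2 ≤ a₁ 0 ^ 2 + b₁ 0 ^ 2 := hmax (show (a', b') ∈ _ from h)
  obtain ⟨c, s, hcs, hrot⟩ := exists_rotation (a₁ 0) (b₁ 0)
  set g : Fin (N + 1) → ℝ := fun k => c * a₁ k + s * b₁ k with hg
  set e : Fin (N + 1) → ℝ := fun k => c * b₁ k - s * a₁ k with he
  have hge (φ) : autocorr φ g + autocorr φ e = autocorr φ a + autocorr φ b :=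
    (autocorr_rotate φ a₁ b₁ c s hcs).trans (hmem φ)
  have hg0 : g 0 ^ 2 = a₁ 0 ^ 2 + b₁ 0 ^ 2 := by
    simp only [hg]
    linear_combination (a₁ 0 ^ 2 + b₁ 0 ^ 2) * hcs - (c * b₁ 0 - s * a₁ 0) * hrot
  have hvanish (j : ℕ) : ∀ b' : Fin (N + 1) → ℝ,
      (∀ φ, autocorr φ g + autocorr φ b' = autocorr φ a + autocorr φ b) →
      ∀ k : Fin (N + 1), (k : ℕ) ≤ j → b' k = 0 := by
    have hzero (b' : Fin (N + 1) → ℝ)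
        (h : ∀ φ, autocorr φ g + autocorr φ b' = autocorr φ a + autocorr φ b) : b' 0 = 0 := by
      have := hmax' g b' h
      exact pow_eq_zero_iff two_ne_zero |>.1 (le_antisymm (by linarith) (sq_nonneg _))
    induction j with
    | zero =>
      intro b' h k hk
      obtain rfl : k = 0 := Fin.ext (by simpa using hk)
      exact hzero b' h
    | succ j ih =>
      intro b' h k hk
      refine Fin.cases (fun _ => hzero b' h) (fun i hi => ?_) k hk
      have := ih (Fin.snoc (fun i : Fin N => b' i.succ) 0 : Fin (N + 1) → ℝ)
        (fun φ => by rw [autocorr_snoc_zero φ b' (hzero b' h), h]) i.castSucc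
        (by simpa using hi)
      simpa using this
  have he0 : e = 0 := funext fun k => hvanish k e hge k le_rfl
  exact ⟨g, fun φ => by rw [← hge φ, he0, autocorr_zero, add_zero]⟩

theorem exists_autocorr_eq_sum {K : ℕ} (hK : 1 ≤ K) {ι : Type*} (s : Finset ι)
    (a : ι → Fin K → ℝ) : ∃ g : Fin K → ℝ, ∀ φ, autocorr φ g = ∑ i ∈ s, autocorr φ (a i) := by
  classical
  obtain ⟨N, rfl⟩ : ∃ N, K = N + 1 := ⟨K - 1, by omega⟩
  induction s using Finset.induction_on with
  | empty => exact ⟨0, fun φ => by simp [autocorr_zero]⟩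
  | insert i s hi ih =>
    obtain ⟨g, hg⟩ := ih
    obtain ⟨g', hg'⟩ := exists_autocorr_eq_add (a i) g
    exact ⟨g', fun φ => by rw [hg', hg, Finset.sum_insert hi]⟩

/-! ### Minimum-norm preimages -/

/-- Every value of `B` is attained at a vector `Bᵀ y` of no larger norm. -/
theorem exists_mul_transpose_mulVec_eq {m n : Type*} [Fintype m] [Fintype n]
    (B : Matrix m n ℝ) (x : n → ℝ) :
    ∃ y : m → ℝ, (B * B.transpose).mulVec y = B.mulVec x ∧
      y ⬝ᵥ (B * B.transpose).mulVec y ≤ x ⬝ᵥ x := by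
  classical
  have hrange : LinearMap.range (B * B.transpose).mulVecLin = LinearMap.range B.mulVecLin := by
    refine Submodule.eq_of_le_of_finrank_eq ?_ (Matrix.rank_self_mul_transpose B)
    rw [Matrix.mulVecLin_mul]
    exact LinearMap.range_comp_le_range _ _
  obtain ⟨y, hy⟩ : B.mulVecLin x ∈ LinearMap.range (B * B.transpose).mulVecLin := by
    rw [hrange]
    exact ⟨x, rfl⟩
  have hy' : (B * B.transpose).mulVec y = B.mulVec x := hy
  refine ⟨y, hy', ?_⟩
  set z := B.transpose.mulVec y with hz
  have h1 : y ⬝ᵥ (B * B.transpose).mulVec y = z ⬝ᵥ z := by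
    rw [← Matrix.mulVec_mulVec, Matrix.dotProduct_mulVec, ← Matrix.mulVec_transpose]
  have h2 : y ⬝ᵥ (B * B.transpose).mulVec y = z ⬝ᵥ x := by
    rw [hy', Matrix.dotProduct_mulVec, ← Matrix.mulVec_transpose]
  have h3 : 0 ≤ (x - z) ⬝ᵥ (x - z) := Finset.sum_nonneg fun i _ => mul_self_nonneg _
  rw [sub_dotProduct, dotProduct_sub, dotProduct_sub, dotProduct_comm x z] at h3
  linarith

/-! ### The predictor as a circular convolution -/

/-- The index `(d - k) mod D`. -/
def backIdx {D : ℕ} (d : Fin D) (k : ℕ) : Fin D :=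
  ⟨D - 1 - (D - 1 - (d : ℕ) + k) % D, by have := d.isLt; omega⟩

theorem backIdx_modEq {D : ℕ} (d : Fin D) (k : ℕ) :
    ((backIdx d k : ℕ) : ℤ) ≡ (d : ℤ) - (k : ℤ) [ZMOD D] := by
  have hd := d.isLt
  have hlt := Nat.mod_lt (D - 1 - (d : ℕ) + k) d.pos
  have hdiv := Nat.div_add_mod (D - 1 - (d : ℕ) + k) D
  have hval : (backIdx d k : ℕ) = D - 1 - (D - 1 - (d : ℕ) + k) % D := rfl
  rw [hval, Int.modEq_iff_dvd]
  refine ⟨-(((D - 1 - (d : ℕ) + k) / D : ℕ) : ℤ), ?_⟩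
  generalize (D - 1 - (d : ℕ) + k) % D = r at *
  generalize (D - 1 - (d : ℕ) + k) / D = q at *
  have hdiv' : (D : ℤ) * q + r = D - 1 - d + k := by
    have : ((D * q + r : ℕ) : ℤ) = ((D - 1 - (d : ℕ) + k : ℕ) : ℤ) := by rw [hdiv]
    push_cast at this
    omega
  have : ((D - 1 - r : ℕ) : ℤ) = D - 1 - r := by omega
  rw [this]
  linear_combination hdiv'

theorem Fin.eq_iff_int_modEq {D : ℕ} (x y : Fin D) : x = y ↔ (x : ℤ) ≡ (y : ℤ) [ZMOD D] := by
  rw [Int.natCast_modEq_iff, Fin.ext_iff]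
  exact ⟨fun h => by rw [h], fun h => Nat.ModEq.eq_of_lt_of_lt h x.isLt y.isLt⟩

theorem backIdx_eq_backIdx_iff {D : ℕ} (d e : Fin D) (k l : ℕ) :
    backIdx d k = backIdx e l ↔ (d : ℤ) - (e : ℤ) ≡ (k : ℤ) - (l : ℤ) [ZMOD D] := by
  have h1 := backIdx_modEq d k
  have h2 := backIdx_modEq e l
  rw [Fin.eq_iff_int_modEq]
  constructor
  · intro h
    have := ((h1.symm.trans h).trans h2).add_right ((k : ℤ) - e)
    ring_nf at this ⊢
    exact this
  · intro h
    refine (h1.trans ?_).trans h2.symm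
    have := h.add_right ((e : ℤ) - k)
    ring_nf at this ⊢
    exact this

theorem backIdx_bijective {D : ℕ} (k : ℕ) :
    Function.Bijective fun d : Fin D => backIdx d k := by
  refine Finite.injective_iff_bijective.1 fun d e h => ?_
  rw [Fin.eq_iff_int_modEq]
  have := (backIdx_eq_backIdx_iff d e k k).1 h
  simpa using this.add_right (e : ℤ)

theorem predictor_apply {K D C : ℕ} (U : Fin K → Fin C → ℝ) (V : Fin D → Fin C → ℝ)
    (d : Fin D) :
    predictor U V d = 1 / Real.sqrt D * ∑ c, ∑ k : Fin K, U k c * V (backIdx d k) c := by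
  rw [Finset.mul_sum]
  rfl

/-- The matrix of `V ↦ ∑ c, ∑ k, U k c * V ((d - k) mod D) c`. -/
def convMatrix {K D C : ℕ} (U : Fin K → Fin C → ℝ) : Matrix (Fin D) (Fin C × Fin D) ℝ :=
  fun d x => ∑ k : Fin K, if x.2 = backIdx d k then U k x.1 else 0

theorem convMatrix_mulVec {K D C : ℕ} (U : Fin K → Fin C → ℝ) (V : Fin C × Fin D → ℝ)
    (d : Fin D) :
    (convMatrix U).mulVec V d = ∑ c, ∑ k : Fin K, U k c * V (c, backIdx d k) := by
  simp only [Matrix.mulVec, dotProduct, convMatrix, Fintype.sum_prod_type, Finset.sum_mul]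
  refine Finset.sum_congr rfl fun c _ => ?_
  rw [Finset.sum_comm]
  simp

theorem convMatrix_mul_transpose {K D C : ℕ} (U : Fin K → Fin C → ℝ) (d e : Fin D) :
    (convMatrix (D := D) U * (convMatrix (D := D) U).transpose) d e =
      ∑ c, autocorr (fun m => if (d : ℤ) - (e : ℤ) ≡ m [ZMOD D] then 1 else 0)
        fun k => U k c := by
  have h : (convMatrix (D := D) U * (convMatrix (D := D) U).transpose) d e =
      (convMatrix U).mulVec (fun x => convMatrix U e x) d := rfl
  rw [h, convMatrix_mulVec]
  refine Finset.sum_congr rfl fun c _ => Finset.sum_congr rfl fun k _ => ?_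
  simp only [convMatrix, Finset.mul_sum]
  refine Finset.sum_congr rfl fun l _ => ?_
  simp only [backIdx_eq_backIdx_iff]
  split_ifs <;> simp

/-- Any multi-channel network can be replaced by a single-channel one of no larger norm. -/
theorem exists_single_channel {K D C : ℕ} (hK : 1 ≤ K) (U : Fin K → Fin C → ℝ)
    (V : Fin D → Fin C → ℝ) :
    ∃ (u : Fin K → Fin 1 → ℝ) (v : Fin D → Fin 1 → ℝ), predictor u v = predictor U V ∧
      (∑ k, ∑ c, u k c ^ 2) + ∑ l, ∑ c, v l c ^ 2 ≤
        (∑ k, ∑ c, U k c ^ 2) + ∑ l, ∑ c, V l c ^ 2 := by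
  obtain ⟨g, hg⟩ := exists_autocorr_eq_sum hK Finset.univ fun (c : Fin C) k => U k c
  set u : Fin K → Fin 1 → ℝ := fun k _ => g k with hu
  set B : Matrix (Fin D) (Fin C × Fin D) ℝ := convMatrix U with hB
  set A : Matrix (Fin D) (Fin 1 × Fin D) ℝ := convMatrix u with hA
  have hAB : A * A.transpose = B * B.transpose := by
    ext d e
    rw [hA, hB, convMatrix_mul_transpose, convMatrix_mul_transpose, ← hg]
    simp [hu]
  obtain ⟨y, hy, hle⟩ := exists_mul_transpose_mulVec_eq B fun x => V x.2 x.1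
  rw [← hAB] at hy hle
  refine ⟨u, fun l c => A.transpose.mulVec y (c, l), ?_, add_le_add (le_of_eq ?_) ?_⟩
  · ext d
    have := congrFun hy d
    rw [← Matrix.mulVec_mulVec, hA, hB, convMatrix_mulVec, convMatrix_mulVec] at this
    rw [predictor_apply, predictor_apply, ← this]
  · have := hg fun m => if m = 0 then 1 else 0
    simp only [autocorr_indicator_zero] at this
    rw [Finset.sum_comm (f := fun k c => U k c ^ 2), ← this]
    simp [hu]
  · rw [← Matrix.mulVec_mulVec, Matrix.dotProduct_mulVec, ← Matrix.mulVec_transpose] at hle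
    simp only [dotProduct, Fintype.sum_prod_type, ← sq] at hle
    rw [Finset.sum_comm, Finset.sum_comm (f := fun l c => V l c ^ 2)]
    exact hle

/-! ### Periodization -/

/-- The average of `f` over the `n` residues of `Fin (n * P)` congruent to `m`. -/
noncomputable def periodAvg {n P : ℕ} (f : Fin (n * P) → ℝ) (m : Fin P) : ℝ :=
  1 / (n : ℝ) * ∑ j : Fin n, f (finProdFinEquiv (j, m))

theorem finProdFinEquiv_modEq {n P : ℕ} (j : Fin n) (m : Fin P) :
    ((finProdFinEquiv (j, m) : ℕ) : ℤ) ≡ (m : ℤ) [ZMOD P] := by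
  simp [finProdFinEquiv, Int.modEq_iff_dvd]

theorem sum_finProdFinEquiv {n P : ℕ} (f : Fin (n * P) → ℝ) (m : Fin P) :
    ∑ j : Fin n, f (finProdFinEquiv (j, m)) =
      ∑ x : Fin (n * P), if (x : ℤ) ≡ (m : ℤ) [ZMOD P] then f x else 0 := by
  rw [← finProdFinEquiv.sum_comp, Fintype.sum_prod_type]
  refine Finset.sum_congr rfl fun j _ => ?_
  have h (i : Fin P) :
      ((finProdFinEquiv (j, i) : ℕ) : ℤ) ≡ (m : ℤ) [ZMOD P] ↔ m = i := by
    rw [eq_comm, Fin.eq_iff_int_modEq]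
    have := finProdFinEquiv_modEq j i
    exact ⟨this.symm.trans, this.trans⟩
  simp only [h, Finset.sum_ite_eq, Finset.mem_univ, if_true]

theorem periodAvg_backIdx {n P : ℕ} (f : Fin (n * P) → ℝ) (m : Fin P) (k : ℕ) :
    periodAvg f (backIdx m k) = periodAvg (fun x => f (backIdx x k)) m := by
  unfold periodAvg
  rw [sum_finProdFinEquiv, sum_finProdFinEquiv (fun x => f (backIdx x k)),
    ← (backIdx_bijective k).sum_comp fun x =>
      if (x : ℤ) ≡ ((backIdx m k : ℕ) : ℤ) [ZMOD P] then f x else 0]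
  congr 1
  refine Finset.sum_congr rfl fun x _ => ?_
  have h1 : ((backIdx x k : ℕ) : ℤ) ≡ (x : ℤ) - (k : ℤ) [ZMOD P] :=
    (backIdx_modEq x k).of_dvd (by push_cast; exact dvd_mul_left _ _)
  have h2 := backIdx_modEq m k
  refine if_congr ?_ rfl rfl
  constructor
  · intro h
    simpa using ((h1.symm.trans h).trans h2).add_right (k : ℤ)
  · intro h
    exact (h1.trans (h.sub_right _)).trans h2.symm

theorem sum_periodAvg_sq_le {n P : ℕ} (hn : 0 < n) (f : Fin (n * P) → ℝ) :
    (n : ℝ) * ∑ m, periodAvg f m ^ 2 ≤ ∑ x, f x ^ 2 := by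
  have hn' : (0 : ℝ) < n := by exact_mod_cast hn
  rw [← finProdFinEquiv.sum_comp, Fintype.sum_prod_type, Finset.sum_comm, Finset.mul_sum]
  refine Finset.sum_le_sum fun m _ => ?_
  have := sq_sum_le_card_mul_sum_sq (s := Finset.univ)
    (f := fun j : Fin n => f (finProdFinEquiv (j, m)))
  rw [Finset.card_univ, Fintype.card_fin] at this
  unfold periodAvg
  rw [mul_pow]
  calc (n : ℝ) * ((1 / n) ^ 2 * (∑ j : Fin n, f (finProdFinEquiv (j, m))) ^ 2)
      = (1 / n) * (∑ j : Fin n, f (finProdFinEquiv (j, m))) ^ 2 := by field_simp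
    _ ≤ (1 / n) * (n * ∑ j : Fin n, f (finProdFinEquiv (j, m)) ^ 2) := by gcongr
    _ = _ := by field_simp

theorem periodAvg_pattern {n P : ℕ} (hn : 0 < n) (hP : 0 < P) (p : Fin P → ℝ) :
    periodAvg (pattern (n * P) hP p) = p := by
  ext m
  have hn' : (n : ℝ) ≠ 0 := by exact_mod_cast hn.ne'
  have h (j : Fin n) : pattern (n * P) hP p (finProdFinEquiv (j, m)) = p m := by
    unfold pattern
    congr 1
    simp [finProdFinEquiv, Nat.mod_eq_of_lt m.isLt]
  simp [periodAvg, h, hn']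

theorem predictor_periodAvg {n P K C : ℕ} (U : Fin K → Fin C → ℝ)
    (V : Fin (n * P) → Fin C → ℝ) :
    predictor (fun k c => 1 / Real.sqrt n * U k c) (fun m c => periodAvg (fun x => V x c) m) =
      periodAvg (predictor U V) := by
  ext m
  simp only [predictor_apply, periodAvg_backIdx]
  simp only [periodAvg, predictor_apply, Finset.mul_sum]
  conv_rhs => rw [Finset.sum_comm]
  refine Finset.sum_congr rfl fun c _ => ?_
  conv_rhs => rw [Finset.sum_comm]
  refine Finset.sum_congr rfl fun k _ => Finset.sum_congr rfl fun j _ => ?_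
  rw [Nat.cast_mul, Real.sqrt_mul (Nat.cast_nonneg n)]
  ring

theorem pattern_backIdx {n P : ℕ} (hP : 0 < P) (f : Fin P → ℝ) (x : Fin (n * P)) (k : ℕ) :
    pattern (n * P) hP f (backIdx x k) = f (backIdx ⟨(x : ℕ) % P, Nat.mod_lt _ hP⟩ k) := by
  unfold pattern
  congr 1
  rw [Fin.eq_iff_int_modEq]
  have h1 : ((backIdx x k : ℕ) : ℤ) ≡ (x : ℤ) - (k : ℤ) [ZMOD P] :=
    (backIdx_modEq x k).of_dvd (by push_cast; exact dvd_mul_left _ _)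
  refine Int.ModEq.trans ?_ (h1.trans (Int.ModEq.trans ?_ (backIdx_modEq _ k).symm))
  · push_cast
    exact Int.mod_modEq _ _
  · push_cast
    exact (Int.mod_modEq _ _).symm.sub_right _

theorem predictor_pattern {n P K C : ℕ} (hn : 0 < n) (hP : 0 < P) (c₀ : Fin C)
    (u : Fin K → Fin 1 → ℝ) (v : Fin P → Fin 1 → ℝ) :
    predictor (fun k c => if c = c₀ then Real.sqrt n * u k 0 else 0)
        (fun x c => if c = c₀ then pattern (n * P) hP (fun m => v m 0) x else 0) =
      pattern (n * P) hP (predictor u v) := by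
  ext x
  have hn' : Real.sqrt n ≠ 0 := Real.sqrt_ne_zero'.2 (by exact_mod_cast hn)
  have hP' : Real.sqrt P ≠ 0 := Real.sqrt_ne_zero'.2 (by exact_mod_cast hP)
  rw [predictor_apply, Finset.sum_eq_single c₀ (fun c _ hc => by simp [hc]) (by simp)]
  simp only [if_true, pattern_backIdx]
  rw [pattern, predictor_apply, Nat.cast_mul, Real.sqrt_mul (Nat.cast_nonneg n)]
  simp only [Finset.univ_unique, Fin.default_eq_zero, Finset.sum_singleton, mul_assoc,
    ← Finset.mul_sum]
  field_simp

theorem sum_pattern_sq {n P : ℕ} (hP : 0 < P) (f : Fin P → ℝ) :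
    ∑ x, pattern (n * P) hP f x ^ 2 = n * ∑ m, f m ^ 2 := by
  rw [← finProdFinEquiv.sum_comp, Fintype.sum_prod_type]
  have h (j : Fin n) (m : Fin P) : pattern (n * P) hP f (finProdFinEquiv (j, m)) = f m := by
    unfold pattern
    congr 1
    simp [finProdFinEquiv, Nat.mod_eq_of_lt m.isLt]
  simp [h]

/-! ### The induced regularizer -/

/-- The costs of the networks realizing `w`. -/
def networkCosts (K D C : ℕ) (w : Fin D → ℝ) : Set ℝ :=
  { t : ℝ | ∃ (U : Fin K → Fin C → ℝ) (V : Fin D → Fin C → ℝ),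
    predictor U V = w ∧ t = (∑ k, ∑ c, (U k c) ^ 2) + ∑ l, ∑ c, (V l c) ^ 2 }

theorem inducedReg_eq_sInf (K D C : ℕ) (w : Fin D → ℝ) :
    inducedReg K D C w = sInf (networkCosts K D C w) := rfl

theorem networkCosts_nonneg {K D C : ℕ} {w : Fin D → ℝ} {t : ℝ}
    (ht : t ∈ networkCosts K D C w) : 0 ≤ t := by
  obtain ⟨U, V, -, rfl⟩ := ht
  positivity

theorem mul_mem_networkCosts_pattern {n P K C : ℕ} (hn : 0 < n) (hP : 0 < P) (hC : 1 ≤ C)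
    {p : Fin P → ℝ} {t : ℝ} (ht : t ∈ networkCosts K P 1 p) :
    (n : ℝ) * t ∈ networkCosts K (n * P) C (pattern (n * P) hP p) := by
  obtain ⟨u, v, rfl, rfl⟩ := ht
  refine ⟨_, _, predictor_pattern hn hP ⟨0, hC⟩ u v, ?_⟩
  simp [ite_pow, mul_pow, sum_pattern_sq, ← Finset.mul_sum, mul_add]

theorem exists_mem_networkCosts_mul_le {n P K C : ℕ} (hn : 0 < n) (hP : 0 < P) (hK : 1 ≤ K)
    {p : Fin P → ℝ} {t : ℝ} (ht : t ∈ networkCosts K (n * P) C (pattern (n * P) hP p)) :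
    ∃ t' ∈ networkCosts K P 1 p, (n : ℝ) * t' ≤ t := by
  obtain ⟨U, V, hUV, rfl⟩ := ht
  have hn' : (0 : ℝ) < n := by exact_mod_cast hn
  obtain ⟨u, v, huv, hle⟩ := exists_single_channel hK (fun k c => 1 / Real.sqrt n * U k c)
    fun m c => periodAvg (fun x => V x c) m
  rw [predictor_periodAvg, hUV, periodAvg_pattern hn] at huv
  refine ⟨_, ⟨u, v, huv, rfl⟩, (mul_le_mul_of_nonneg_left hle hn'.le).trans ?_⟩
  rw [mul_add]
  refine add_le_add (le_of_eq ?_) ?_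
  · simp only [mul_pow, div_pow, Real.sq_sqrt hn'.le, ← Finset.mul_sum]
    field_simp
  · rw [Finset.sum_comm, Finset.sum_comm (f := fun l c => V l c ^ 2), Finset.mul_sum]
    exact Finset.sum_le_sum fun c _ => sum_periodAvg_sq_le hn fun x => V x c

theorem inducedReg_dim_zero (K C : ℕ) (w : Fin 0 → ℝ) : inducedReg K 0 C w = 0 := by
  rw [inducedReg_eq_sInf]
  refine IsLeast.csInf_eq ⟨⟨0, 0, Subsingleton.elim _ _, by simp⟩, ?_⟩
  exact fun t ht => networkCosts_nonneg ht

theorem inducedReg_pattern_mul {n P K C : ℕ} (hn : 0 < n) (hP : 0 < P) (hK : 1 ≤ K)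
    (hC : 1 ≤ C) (p : Fin P → ℝ) :
    inducedReg K (n * P) C (pattern (n * P) hP p) = n * inducedReg K P 1 p := by
  rw [inducedReg_eq_sInf, inducedReg_eq_sInf]
  have hn' : (0 : ℝ) < n := by exact_mod_cast hn
  have hbdd {K D C : ℕ} {w : Fin D → ℝ} : BddBelow (networkCosts K D C w) :=
    ⟨0, fun t ht => networkCosts_nonneg ht⟩
  rcases (networkCosts K P 1 p).eq_empty_or_nonempty with hem | hne
  · have : networkCosts K (n * P) C (pattern (n * P) hP p) = ∅ := by
      refine Set.eq_empty_of_forall_notMem fun t ht => ?_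
      obtain ⟨t', ht', -⟩ := exists_mem_networkCosts_mul_le hn hP hK ht
      simp [hem] at ht'
    rw [this, hem, Real.sInf_empty, mul_zero]
  · apply le_antisymm
    · rw [← div_le_iff₀' hn']
      refine le_csInf hne fun t ht => ?_
      rw [div_le_iff₀' hn']
      exact csInf_le hbdd (mul_mem_networkCosts_pattern hn hP hC ht)
    · refine le_csInf (hne.image (fun t => (n : ℝ) * t) |>.mono ?_) fun t ht => ?_
      · rintro _ ⟨t, ht, rfl⟩
        exact mul_mem_networkCosts_pattern hn hP hC ht
      · obtain ⟨t', ht', hle⟩ := exists_mem_networkCosts_mul_le hn hP hK ht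
        exact (mul_le_mul_of_nonneg_left (csInf_le hbdd ht') hn'.le).trans hle

/-- Patterned vectors, small kernels: for `K ≤ P` and `P ∣ D`,
`R_{K,C}(w(p)) = (D/P)·R^P_{K,1}(p)`. -/
theorem induced_reg_patterned_small_kernel (D P K C : ℕ) (hP : 0 < P) (hPD : P ∣ D)
    (hK : 1 ≤ K) (hKP : K ≤ P) (hC : 1 ≤ C) (p : Fin P → ℝ) :
    inducedReg K D C (pattern D hP p) = ((D : ℝ) / (P : ℝ)) * inducedReg K P 1 p := by
  have hP' : (P : ℝ) ≠ 0 := by exact_mod_cast hP.ne'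
  obtain ⟨n, rfl⟩ := hPD
  rcases Nat.eq_zero_or_pos n with rfl | hn
  · simpa using inducedReg_dim_zero K C _
  · obtain ⟨D, hD⟩ : ∃ D, D = P * n := ⟨_, rfl⟩
    rw [← hD]
    obtain rfl : D = n * P := by rw [hD, mul_comm]
    rw [inducedReg_pattern_mul hn hP hK hC, Nat.cast_mul, mul_div_assoc, div_self hP', mul_one]
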